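/- Let π be a probability density on ℝ that is symmetric about 0 and unimodal, with CDF Π, finite strictly positive variance σ², and let φ be a probability density symmetric about 0. Then σ² − 2 ∫_0^∞ x² φ(x)(1 − Π(x/2)) dx > 0. -/

import Mathlib

open MeasureTheory Set

/-- Gauss' inequality for a nonincreasing density on the half line. -/
lemma gauss_half (π : ℝ → ℝ) (hπnonneg : ∀ x, 0 ≤ π x)
    (hπint : Integrable π) (hanti : AntitoneOn π (Set.Ici (0 : ℝ)))
    (hmom : Integrable (fun x => x ^ 2 * π x)) (y : ℝ) (hy : 0 < y) :
    2 * y ^ 2 * ∫ x in Ioi y, π x ≤ 8 / 9 * ∫ x in Ioi (0 : ℝ), x ^ 2 * π x := by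
  have i1 : Integrable ((Ioc 0 (3 / 2 * y)).indicator (fun x : ℝ => x ^ 2)) := by
    rw [integrable_indicator_iff measurableSet_Ioc]
    exact ((continuous_pow 2).integrableOn_Icc).mono_set Ioc_subset_Icc_self
  have i2 : Integrable ((Ioc y (3 / 2 * y)).indicator (fun _ : ℝ => (1 : ℝ))) := by
    rw [integrable_indicator_iff measurableSet_Ioc]
    exact (continuous_const.integrableOn_Icc).mono_set Ioc_subset_Icc_self
  have i3 : Integrable ((Ioi (0 : ℝ)).indicator (fun x : ℝ => x ^ 2 * π x)) :=
    hmom.indicator measurableSet_Ioi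
  have i4 : Integrable ((Ioi y).indicator π) := hπint.indicator measurableSet_Ioi
  have key : ∫ x, (π y * (8 / 9) * (Ioc 0 (3 / 2 * y)).indicator (fun x : ℝ => x ^ 2) x
        - π y * (2 * y ^ 2) * (Ioc y (3 / 2 * y)).indicator (fun _ : ℝ => (1 : ℝ)) x)
      ≤ ∫ x, (8 / 9 * (Ioi (0 : ℝ)).indicator (fun x : ℝ => x ^ 2 * π x) x
        - 2 * y ^ 2 * (Ioi y).indicator π x) := by
    refine integral_mono ((i1.const_mul _).sub (i2.const_mul _))
      ((i3.const_mul _).sub (i4.const_mul _)) ?_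
    intro x
    simp only [indicator_apply, mem_Ioc, mem_Ioi]
    have hp := hπnonneg x
    rcases le_or_gt x 0 with h0 | h0
    · have a1 : ¬ (0 < x) := not_lt.mpr h0
      have a2 : ¬ (y < x) := by linarith
      simp [a1, a2]
    rcases le_or_gt x y with h1 | h1
    · have a2 : ¬ (y < x) := not_lt.mpr h1
      have a3 : x ≤ 3 / 2 * y := by linarith
      have := hanti h0.le hy.le h1
      simp only [h0, a2, a3, and_self, false_and, if_true, if_false]
      nlinarith [mul_le_mul_of_nonneg_left this (sq_nonneg x)]
    have hle := hanti hy.le h0.le h1.le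
    rcases le_or_gt x (3 / 2 * y) with h2 | h2
    · simp only [h0, h1, h2, and_self, if_true]
      have : 8 / 9 * x ^ 2 ≤ 2 * y ^ 2 := by nlinarith
      nlinarith [mul_nonneg (sub_nonneg.2 hle) (sub_nonneg.2 this)]
    · have a3 : ¬ (x ≤ 3 / 2 * y) := not_le.mpr h2
      simp only [h0, h1, a3, and_false, if_true, if_false]
      have : 2 * y ^ 2 ≤ 8 / 9 * x ^ 2 := by nlinarith
      nlinarith [mul_nonneg hp (sub_nonneg.2 this)]
  rw [integral_sub (i1.const_mul _) (i2.const_mul _),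
    integral_sub (i3.const_mul _) (i4.const_mul _)] at key
  simp only [integral_const_mul] at key
  rw [integral_indicator measurableSet_Ioc, integral_indicator measurableSet_Ioc,
    integral_indicator measurableSet_Ioi, integral_indicator measurableSet_Ioi,
    ← intervalIntegral.integral_of_le (by linarith),
    ← intervalIntegral.integral_of_le (by linarith)] at key
  simp only [integral_pow, intervalIntegral.integral_const, smul_eq_mul] at key
  norm_num at key
  ring_nf at key ⊢
  linarith

/-- Positivity of the unit-lag covariance before the change of variables:
`σ² − 2 ∫_0^∞ x² φ(x)(1 − Π(x/2)) dx > 0`. -/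
theorem covariance_pos_pre_change_of_variables
    (π φ : ℝ → ℝ) (hπmeas : Measurable π) (hφmeas : Measurable φ)
    (hπnonneg : ∀ x, 0 ≤ π x) (hφnonneg : ∀ x, 0 ≤ φ x)
    (hπint : Integrable π) (hφint : Integrable φ)
    (hπone : ∫ x, π x = 1) (hφone : ∫ x, φ x = 1)
    (hπsymm : ∀ t, π t = π (-t)) (hφsymm : ∀ t, φ t = φ (-t))
    (hmono : MonotoneOn π (Set.Iic (0 : ℝ)))
    (hanti : AntitoneOn π (Set.Ici (0 : ℝ)))
    (hmom : Integrable (fun x => x ^ 2 * π x))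
    (hvarpos : 0 < ∫ x, x ^ 2 * π x) :
    0 < (∫ x, x ^ 2 * π x)
        - 2 * ∫ x in Set.Ioi (0 : ℝ),
            x ^ 2 * φ x * (1 - ∫ t in Set.Iic (x / 2), π t) := by
  have habs : ∀ f : ℝ → ℝ, (∀ t, f t = f (-t)) → ∀ x, f |x| = f x := by
    intro f hf x
    rcases abs_choice x with h | h <;> rw [h]
    exact (hf x).symm
  have hφhalf : 1 = 2 * ∫ x in Ioi (0 : ℝ), φ x := by
    rw [← integral_comp_abs, ← hφone]
    exact integral_congr_ae (ae_of_all _ fun x => (habs φ hφsymm x).symm)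
  have hvhalf : ∫ x, x ^ 2 * π x = 2 * ∫ x in Ioi (0 : ℝ), x ^ 2 * π x := by
    rw [← integral_comp_abs (f := fun x => x ^ 2 * π x)]
    refine integral_congr_ae (ae_of_all _ fun x => ?_)
    simp only [sq_abs, habs π hπsymm x]
  have hT : ∀ z, 1 - ∫ t in Iic z, π t = ∫ t in Ioi z, π t := by
    intro z
    have := intervalIntegral.integral_Iic_add_Ioi (b := z) (μ := volume) (f := π)
      hπint.integrableOn hπint.integrableOn
    linarith
  have hb : ∫ x in Ioi (0 : ℝ), x ^ 2 * φ x * (1 - ∫ t in Iic (x / 2), π t)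
      ≤ ∫ x in Ioi (0 : ℝ), 8 / 9 * (∫ x, x ^ 2 * π x) * φ x := by
    refine integral_mono_of_nonneg ?_ (hφint.integrableOn.const_mul _) ?_
    · refine ae_of_all _ fun x => ?_
      simp only [hT]
      exact mul_nonneg (mul_nonneg (sq_nonneg x) (hφnonneg x))
        (integral_nonneg hπnonneg)
    · filter_upwards [ae_restrict_mem measurableSet_Ioi] with x hx
      have hx' : 0 < x / 2 := half_pos hx
      have g := gauss_half π hπnonneg hπint hanti hmom (x / 2) hx'
      simp only [hT]
      rw [hvhalf]
      nlinarith [mul_le_mul_of_nonneg_left g (hφnonneg x)]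
  rw [integral_const_mul] at hb
  have : ∫ x in Ioi (0 : ℝ), φ x = 1 / 2 := by linarith
  rw [this] at hb
  linarith
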